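/- arXiv:1301.5458 — 2 statements merged into one kernel-verified Lean document; each statement's English description precedes it below -/
import Mathlib

section
/- (Lemma on the sign of the second derivative of the deviation scalar, extremal case.) Let m > 0, q = m, and r_* ∈ (m, 3m/2). Set β = 2(r_* − m)/r_*², let α₁ < α₂ < α₃ be the three real roots of the cubic Q, define F(x) = (β²/x²)(x − r_*)(x − α₁)(x − α₂)(x − α₃), G(x) = (1/2)·F′(x), χ(x) = 2m/x³ − 3m²/x⁴, ζ = −2(r_* − 2m)/r_*³, ω_* = r_*/(r_* − m), ω̇_* = (3m² − 2r_*²)/((3m − 2r_*)(m − r_*)²) and ω̈_* = 2m(r_* − 2m)/(r_*(3m − 2r_*)(m − r_*)²). Suppose ω : (α₂, r_*] → ℝ is twice continuously differentiable, satisfies F(x)·ω″(x) + G(x)·ω′(x) − (β² + χ(x))·ω(x) = ζ for all x ∈ (α₂, r_*), and has boundary values ω(r_*) = ω_*, ω′(r_*) = ω̇_* and ω″(r_*) = ω̈_*. Then ω″(x) < ω̈_* for all x ∈ (α₂, r_*). -/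
/-- The metric function `D(r) = 1 - 2m/r + q²/r²`; in the extremal case `q = m` it equals
`(1 - m/r)²`. -/
noncomputable def D (m q r : ℝ) : ℝ := 1 - 2*m/r + q^2/r^2

/-- The constant `β = 2√(D(r_*))/r_*` associated to the conformal curve starting at `r_*`. -/
noncomputable def betaConst (m q rs : ℝ) : ℝ := 2 * Real.sqrt (D m q rs) / rs

/-- The coefficient `η = (D_* - 1)/β²` of the cubic `Q`. -/
noncomputable def etaCoeff (m q rs : ℝ) : ℝ := (D m q rs - 1) / (betaConst m q rs)^2

/-- The coefficient `ξ = q²/(r_*·β²)` of the cubic `Q`. -/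
noncomputable def xiCoeff (m q rs : ℝ) : ℝ := q^2 / (rs * (betaConst m q rs)^2)

/-- The cubic `Q(x) = x³ + ηx + ξ`. -/
noncomputable def Qcubic (m q rs x : ℝ) : ℝ := x^3 + etaCoeff m q rs * x + xiCoeff m q rs

/-- The coefficient `F(x) = (β²/x²)(x - r_*)(x - α₁)(x - α₂)(x - α₃)` (the square `r̄′²`
of the radial velocity expressed as a function of the radial coordinate), extremal case
`β = 2(r_* - m)/r_*²`. -/
noncomputable def Fcoeff (m rs a₁ a₂ a₃ x : ℝ) : ℝ :=
  ((2*(rs - m)/rs^2)^2 / x^2) * (x - rs) * (x - a₁) * (x - a₂) * (x - a₃)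

lemma bern_0 (s : ℝ) (h0 : 0 < s) (h1 : s < 5/8) :
    0 < 4*s^0 + 41*s^1 + 147*s^2 + 176*s^3 - 201*s^4 - 788*s^5 - 722*s^6 + 100*s^7 + 658*s^8 +
      485*s^9 + 127*s^10 - 12*s^11 - 13*s^12 - 2*s^13 := by
  obtain ⟨h, hh⟩ : ∃ h, h = 5 - 8*s := ⟨_, rfl⟩
  have hp : 0 < h := by linarith
  have key : (5:ℝ)^13 * (4*s^0 + 41*s^1 + 147*s^2 + 176*s^3 - 201*s^4 - 788*s^5 - 722*s^6 + 100*s^7 + 658*s^8 +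
      485*s^9 + 127*s^10 - 12*s^11 - 13*s^12 - 2*s^13) =
      4*s^0*h^13 + 621*s^1*h^12 + 43323*s^2*h^11 + 1797048*s^3*h^10 + 49376135*s^4*h^9 +
      946647764*s^5*h^8 + 12980351646*s^6*h^7 + 128169219108*s^7*h^6 + 903640360338*s^8*h^5 +
      4432601099305*s^9*h^4 + 14365136785831*s^10*h^3 + 27812775550924*s^11*h^2 +
      25620323213667*s^12*h^1 + 4563421228782*s^13*h^0 := by
    subst hh; ring
  have h2 : 0 < (5:ℝ)^13 * (4*s^0 + 41*s^1 + 147*s^2 + 176*s^3 - 201*s^4 - 788*s^5 - 722*s^6 + 100*s^7 + 658*s^8 +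
      485*s^9 + 127*s^10 - 12*s^11 - 13*s^12 - 2*s^13) := by
    rw [key]; positivity
  exact pos_of_mul_pos_right h2 (by positivity)

lemma bern_1 (s : ℝ) (h0 : 0 < s) (h1 : s < 5/8) :
    0 < 16*s^0 + 56*s^1 + 45*s^2 + 92*s^3 + 440*s^4 + 434*s^5 - 800*s^6 - 2304*s^7 - 2249*s^8 -
      537*s^9 + 1032*s^10 + 1163*s^11 + 501*s^12 + 75*s^13 - 9*s^14 - 3*s^15 := by
  obtain ⟨h, hh⟩ : ∃ h, h = 5 - 8*s := ⟨_, rfl⟩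
  have hp : 0 < h := by linarith
  have key : (5:ℝ)^15 * (16*s^0 + 56*s^1 + 45*s^2 + 92*s^3 + 440*s^4 + 434*s^5 - 800*s^6 - 2304*s^7 - 2249*s^8 -
      537*s^9 + 1032*s^10 + 1163*s^11 + 501*s^12 + 75*s^13 - 9*s^14 - 3*s^15) =
      16*s^0*h^15 + 2200*s^1*h^14 + 140005*s^2*h^13 + 5486580*s^3*h^12 + 148634680*s^4*h^11 +
      2961331994*s^5*h^10 + 45015001600*s^6*h^9 + 533162378880*s^7*h^8 + 4961022765655*s^8*h^7 +
      36108564736555*s^9*h^6 + 201891936574232*s^10*h^5 + 837487486069375*s^11*h^4 +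
      2429541733919845*s^12*h^3 + 4439814429038495*s^13*h^2 + 4091371634775295*s^14*h^1 +
      837494700359057*s^15*h^0 := by
    subst hh; ring
  have h2 : 0 < (5:ℝ)^15 * (16*s^0 + 56*s^1 + 45*s^2 + 92*s^3 + 440*s^4 + 434*s^5 - 800*s^6 - 2304*s^7 - 2249*s^8 -
      537*s^9 + 1032*s^10 + 1163*s^11 + 501*s^12 + 75*s^13 - 9*s^14 - 3*s^15) := by
    rw [key]; positivity
  exact pos_of_mul_pos_right h2 (by positivity)

lemma bern_2 (s : ℝ) (h0 : 0 < s) (h1 : s < 5/8) :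
    0 < 32*s^0 + 96*s^1 - 38*s^2 - 14*s^3 + 698*s^4 + 861*s^5 - 336*s^6 - 1845*s^7 - 2887*s^8 -
      2964*s^9 - 1871*s^10 - 376*s^11 + 437*s^12 + 387*s^13 + 125*s^14 + 15*s^15 := by
  obtain ⟨h, hh⟩ : ∃ h, h = 5 - 8*s := ⟨_, rfl⟩
  have hp : 0 < h := by linarith
  have key : (5:ℝ)^15 * (32*s^0 + 96*s^1 - 38*s^2 - 14*s^3 + 698*s^4 + 861*s^5 - 336*s^6 - 1845*s^7 - 2887*s^8 -
      2964*s^9 - 1871*s^10 - 376*s^11 + 437*s^12 + 387*s^13 + 125*s^14 + 15*s^15) =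
      32*s^0*h^15 + 4320*s^1*h^14 + 267850*s^2*h^13 + 10149690*s^3*h^12 + 263895770*s^4*h^11 +
      5011498033*s^5*h^10 + 72239992320*s^6*h^9 + 810179691375*s^7*h^8 + 7169298706265*s^8*h^7 +
      50202639801620*s^9*h^6 + 275139121559209*s^10*h^5 + 1145930205520080*s^11*h^4 +
      3429511140982725*s^12*h^3 + 6656424242737335*s^13*h^2 + 6738688004658805*s^14*h^1 +
      1642811467947819*s^15*h^0 := by
    subst hh; ring
  have h2 : 0 < (5:ℝ)^15 * (32*s^0 + 96*s^1 - 38*s^2 - 14*s^3 + 698*s^4 + 861*s^5 - 336*s^6 - 1845*s^7 - 2887*s^8 -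
      2964*s^9 - 1871*s^10 - 376*s^11 + 437*s^12 + 387*s^13 + 125*s^14 + 15*s^15) := by
    rw [key]; positivity
  exact pos_of_mul_pos_right h2 (by positivity)

lemma bern_3 (s : ℝ) (h0 : 0 < s) (h1 : s < 5/8) :
    0 < 16*s^0 + 24*s^1 + 162*s^2 + 92*s^3 - 418*s^4 + 628*s^5 + 1906*s^6 - 352*s^7 - 3106*s^8 -
      3359*s^9 - 2763*s^10 - 2004*s^11 - 1082*s^12 - 395*s^13 - 91*s^14 - 10*s^15 := by
  obtain ⟨h, hh⟩ : ∃ h, h = 5 - 8*s := ⟨_, rfl⟩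
  have hp : 0 < h := by linarith
  have key : (5:ℝ)^15 * (16*s^0 + 24*s^1 + 162*s^2 + 92*s^3 - 418*s^4 + 628*s^5 + 1906*s^6 - 352*s^7 - 3106*s^8 -
      3359*s^9 - 2763*s^10 - 2004*s^11 - 1082*s^12 - 395*s^13 - 91*s^14 - 10*s^15) =
      16*s^0*h^15 + 2040*s^1*h^14 + 125010*s^2*h^13 + 4858940*s^3*h^12 + 132881150*s^4*h^11 +
      2687046484*s^5*h^10 + 41288209090*s^6*h^9 + 490202096560*s^7*h^8 + 4544464872990*s^8*h^7 +
      33044418352725*s^9*h^6 + 187559450655997*s^10*h^5 + 813840505086660*s^11*h^4 +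
      2572991672839590*s^12*h^3 + 5381672130633385*s^13*h^2 + 6038188621451325*s^14*h^1 +
      1786335642747942*s^15*h^0 := by
    subst hh; ring
  have h2 : 0 < (5:ℝ)^15 * (16*s^0 + 24*s^1 + 162*s^2 + 92*s^3 - 418*s^4 + 628*s^5 + 1906*s^6 - 352*s^7 - 3106*s^8 -
      3359*s^9 - 2763*s^10 - 2004*s^11 - 1082*s^12 - 395*s^13 - 91*s^14 - 10*s^15) := by
    rw [key]; positivity
  exact pos_of_mul_pos_right h2 (by positivity)

lemma bern_4 (s : ℝ) (h0 : 0 < s) (h1 : s < 5/8) :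
    0 < 12*s^0 + 45*s^1 + 75*s^2 + 174*s^3 - 229*s^4 - 53*s^5 + 1597*s^6 + 410*s^7 - 2753*s^8 -
      2902*s^9 - 1684*s^10 - 1026*s^11 - 490*s^12 - 112*s^13 - 8*s^14 := by
  obtain ⟨h, hh⟩ : ∃ h, h = 5 - 8*s := ⟨_, rfl⟩
  have hp : 0 < h := by linarith
  have key : (5:ℝ)^14 * (12*s^0 + 45*s^1 + 75*s^2 + 174*s^3 - 229*s^4 - 53*s^5 + 1597*s^6 + 410*s^7 - 2753*s^8 -
      2902*s^9 - 1684*s^10 - 1026*s^11 - 490*s^12 - 112*s^13 - 8*s^14) =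
      12*s^0*h^14 + 1569*s^1*h^13 + 95163*s^2*h^12 + 3561366*s^3*h^11 + 91839227*s^4*h^10 +
      1722306807*s^5*h^9 + 24175282909*s^6*h^8 + 258096257618*s^7*h^7 + 2112928630351*s^8*h^6 +
      13265014765922*s^9*h^5 + 63003853999388*s^10*h^4 + 217689839736006*s^11*h^3 +
      501137866269062*s^12*h^2 + 630983681847984*s^13*h^1 + 232616942629048*s^14*h^0 := by
    subst hh; ring
  have h2 : 0 < (5:ℝ)^14 * (12*s^0 + 45*s^1 + 75*s^2 + 174*s^3 - 229*s^4 - 53*s^5 + 1597*s^6 + 410*s^7 - 2753*s^8 -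
      2902*s^9 - 1684*s^10 - 1026*s^11 - 490*s^12 - 112*s^13 - 8*s^14) := by
    rw [key]; positivity
  exact pos_of_mul_pos_right h2 (by positivity)

lemma bern_5 (s : ℝ) (h0 : 0 < s) (h1 : s < 5/8) :
    0 < 1*s^0 + 24*s^1 + 26*s^2 + 134*s^3 + 99*s^4 - 344*s^5 + 291*s^6 + 643*s^7 - 1023*s^8 -
      1489*s^9 - 470*s^10 + 36*s^11 + 24*s^12 := by
  obtain ⟨h, hh⟩ : ∃ h, h = 5 - 8*s := ⟨_, rfl⟩
  have hp : 0 < h := by linarith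
  have key : (5:ℝ)^12 * (1*s^0 + 24*s^1 + 26*s^2 + 134*s^3 + 99*s^4 - 344*s^5 + 291*s^6 + 643*s^7 - 1023*s^8 -
      1489*s^9 - 470*s^10 + 36*s^11 + 24*s^12) =
      1*s^0*h^12 + 216*s^1*h^11 + 15434*s^2*h^10 + 603790*s^3*h^9 + 15304995*s^4*h^8 +
      269566856*s^5*h^7 + 3393593851*s^6*h^6 + 30803978519*s^7*h^5 + 200743026745*s^8*h^4 +
      916574657835*s^9*h^3 + 2735170350434*s^10*h^2 + 4461752919284*s^11*h^1 +
      2267630472376*s^12*h^0 := by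
    subst hh; ring
  have h2 : 0 < (5:ℝ)^12 * (1*s^0 + 24*s^1 + 26*s^2 + 134*s^3 + 99*s^4 - 344*s^5 + 291*s^6 + 643*s^7 - 1023*s^8 -
      1489*s^9 - 470*s^10 + 36*s^11 + 24*s^12) := by
    rw [key]; positivity
  exact pos_of_mul_pos_right h2 (by positivity)

lemma bern_6 (s : ℝ) (h0 : 0 < s) (h1 : s < 5/8) :
    0 < 1*s^0 + 54*s^1 + 137*s^2 - 113*s^3 - 303*s^4 + 141*s^5 + 147*s^6 - 128*s^7 - 104*s^8 -
      16*s^9 := by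
  obtain ⟨h, hh⟩ : ∃ h, h = 5 - 8*s := ⟨_, rfl⟩
  have hp : 0 < h := by linarith
  have key : (5:ℝ)^9 * (1*s^0 + 54*s^1 + 137*s^2 - 113*s^3 - 303*s^4 + 141*s^5 + 147*s^6 - 128*s^7 - 104*s^8 -
      16*s^9) =
      1*s^0*h^9 + 342*s^1*h^8 + 23009*s^2*h^7 + 704523*s^3*h^6 + 11993361*s^4*h^5 +
      122224793*s^5*h^4 + 759037131*s^6*h^3 + 2791029512*s^7*h^2 + 5453032664*s^8*h^1 +
      3923137648*s^9*h^0 := by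
    subst hh; ring
  have h2 : 0 < (5:ℝ)^9 * (1*s^0 + 54*s^1 + 137*s^2 - 113*s^3 - 303*s^4 + 141*s^5 + 147*s^6 - 128*s^7 - 104*s^8 -
      16*s^9) := by
    rw [key]; positivity
  exact pos_of_mul_pos_right h2 (by positivity)

lemma bern_7 (s : ℝ) (h0 : 0 < s) (h1 : s < 5/8) :
    0 < 18*s^0 + 15*s^1 - 55*s^2 - 10*s^3 + 40*s^4 + 16*s^5 := by
  obtain ⟨h, hh⟩ : ∃ h, h = 5 - 8*s := ⟨_, rfl⟩
  have hp : 0 < h := by linarith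
  have key : (5:ℝ)^5 * (18*s^0 + 15*s^1 - 55*s^2 - 10*s^3 + 40*s^4 + 16*s^5) =
      18*s^0*h^5 + 795*s^1*h^4 + 12545*s^2*h^3 + 86710*s^3*h^2 + 263240*s^4*h^1 + 363024*s^5*h^0 := by
    subst hh; ring
  have h2 : 0 < (5:ℝ)^5 * (18*s^0 + 15*s^1 - 55*s^2 - 10*s^3 + 40*s^4 + 16*s^5) := by
    rw [key]; positivity
  exact pos_of_mul_pos_right h2 (by positivity)

set_option maxHeartbeats 4000000 in
lemma R_ident (s u : ℝ) : 32 * (1 - s - s^2)^7 * (1*u^0*s^4 + 5*u^0*s^5 + 10*u^0*s^6 + 10*u^0*s^7 + 5*u^0*s^8 + 1*u^0*s^9 - 5*u^1*s^3 -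
      26*u^1*s^4 - 55*u^1*s^5 - 60*u^1*s^6 - 35*u^1*s^7 - 10*u^1*s^8 - 1*u^1*s^9 - 2*u^2*s^1 -
      4*u^2*s^2 + 26*u^2*s^3 + 100*u^2*s^4 + 140*u^2*s^5 + 98*u^2*s^6 + 36*u^2*s^7 + 6*u^2*s^8 +
      4*u^3*s^0 + 30*u^3*s^1 + 58*u^3*s^2 + 28*u^3*s^3 - 30*u^3*s^4 - 46*u^3*s^5 - 30*u^3*s^6 -
      12*u^3*s^7 - 2*u^3*s^8 - 26*u^4*s^0 - 122*u^4*s^1 - 215*u^4*s^2 - 265*u^4*s^3 -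
      260*u^4*s^4 - 148*u^4*s^5 - 47*u^4*s^6 - 5*u^4*s^7 + 61*u^5*s^0 + 198*u^5*s^1 +
      297*u^5*s^2 + 348*u^5*s^3 + 263*u^5*s^4 + 98*u^5*s^5 + 15*u^5*s^6 - 60*u^6*s^0 -
      128*u^6*s^1 - 142*u^6*s^2 - 118*u^6*s^3 - 42*u^6*s^4 - 6*u^6*s^5 + 20*u^7*s^0 + 24*u^7*s^1
      + 16*u^7*s^2 + 4*u^7*s^3) =
      s^4 * (4*s^0 + 41*s^1 + 147*s^2 + 176*s^3 - 201*s^4 - 788*s^5 - 722*s^6 + 100*s^7 + 658*s^8 +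
      485*s^9 + 127*s^10 - 12*s^11 - 13*s^12 - 2*s^13) * (2*u - s - s^2)^0 * (1 - 2*u)^7 +
      s^2 * (16*s^0 + 56*s^1 + 45*s^2 + 92*s^3 + 440*s^4 + 434*s^5 - 800*s^6 - 2304*s^7 - 2249*s^8 -
      537*s^9 + 1032*s^10 + 1163*s^11 + 501*s^12 + 75*s^13 - 9*s^14 - 3*s^15) * (2*u - s - s^2)^1 * (1 - 2*u)^6 +
      s^1 * (32*s^0 + 96*s^1 - 38*s^2 - 14*s^3 + 698*s^4 + 861*s^5 - 336*s^6 - 1845*s^7 - 2887*s^8 -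
      2964*s^9 - 1871*s^10 - 376*s^11 + 437*s^12 + 387*s^13 + 125*s^14 + 15*s^15) * (2*u - s - s^2)^2 * (1 - 2*u)^5 +
      s^0 * (16*s^0 + 24*s^1 + 162*s^2 + 92*s^3 - 418*s^4 + 628*s^5 + 1906*s^6 - 352*s^7 - 3106*s^8 -
      3359*s^9 - 2763*s^10 - 2004*s^11 - 1082*s^12 - 395*s^13 - 91*s^14 - 10*s^15) * (2*u - s - s^2)^3 * (1 - 2*u)^4 +
      s^0 * (12*s^0 + 45*s^1 + 75*s^2 + 174*s^3 - 229*s^4 - 53*s^5 + 1597*s^6 + 410*s^7 - 2753*s^8 -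
      2902*s^9 - 1684*s^10 - 1026*s^11 - 490*s^12 - 112*s^13 - 8*s^14) * (2*u - s - s^2)^4 * (1 - 2*u)^3 +
      s^0 * (1*s^0 + 24*s^1 + 26*s^2 + 134*s^3 + 99*s^4 - 344*s^5 + 291*s^6 + 643*s^7 - 1023*s^8 -
      1489*s^9 - 470*s^10 + 36*s^11 + 24*s^12) * (2*u - s - s^2)^5 * (1 - 2*u)^2 +
      s^2 * (1*s^0 + 54*s^1 + 137*s^2 - 113*s^3 - 303*s^4 + 141*s^5 + 147*s^6 - 128*s^7 - 104*s^8 -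
      16*s^9) * (2*u - s - s^2)^6 * (1 - 2*u)^1 +
      s^4 * (18*s^0 + 15*s^1 - 55*s^2 - 10*s^3 + 40*s^4 + 16*s^5) * (2*u - s - s^2)^7 * (1 - 2*u)^0 := by
  ring

lemma R_pos (s u : ℝ) (hs : 0 < s) (hu : u < 1/2) (hd : s + s^2 < 2*u) :
    0 < 1*u^0*s^4 + 5*u^0*s^5 + 10*u^0*s^6 + 10*u^0*s^7 + 5*u^0*s^8 + 1*u^0*s^9 - 5*u^1*s^3 -
      26*u^1*s^4 - 55*u^1*s^5 - 60*u^1*s^6 - 35*u^1*s^7 - 10*u^1*s^8 - 1*u^1*s^9 - 2*u^2*s^1 -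
      4*u^2*s^2 + 26*u^2*s^3 + 100*u^2*s^4 + 140*u^2*s^5 + 98*u^2*s^6 + 36*u^2*s^7 + 6*u^2*s^8 +
      4*u^3*s^0 + 30*u^3*s^1 + 58*u^3*s^2 + 28*u^3*s^3 - 30*u^3*s^4 - 46*u^3*s^5 - 30*u^3*s^6 -
      12*u^3*s^7 - 2*u^3*s^8 - 26*u^4*s^0 - 122*u^4*s^1 - 215*u^4*s^2 - 265*u^4*s^3 -
      260*u^4*s^4 - 148*u^4*s^5 - 47*u^4*s^6 - 5*u^4*s^7 + 61*u^5*s^0 + 198*u^5*s^1 +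
      297*u^5*s^2 + 348*u^5*s^3 + 263*u^5*s^4 + 98*u^5*s^5 + 15*u^5*s^6 - 60*u^6*s^0 -
      128*u^6*s^1 - 142*u^6*s^2 - 118*u^6*s^3 - 42*u^6*s^4 - 6*u^6*s^5 + 20*u^7*s^0 + 24*u^7*s^1
      + 16*u^7*s^2 + 4*u^7*s^3 := by
  have h58 : s < 5/8 := by nlinarith
  have hd' : 0 < 2*u - s - s^2 := by linarith
  have he' : 0 < 1 - 2*u := by linarith
  have hg : 0 < 1 - s - s^2 := by linarith
  have b0 := bern_0 s hs h58
  have b1 := bern_1 s hs h58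
  have b2 := bern_2 s hs h58
  have b3 := bern_3 s hs h58
  have b4 := bern_4 s hs h58
  have b5 := bern_5 s hs h58
  have b6 := bern_6 s hs h58
  have b7 := bern_7 s hs h58
  have key := R_ident s u
  have h2 : 0 < 32 * (1 - s - s^2)^7 * (1*u^0*s^4 + 5*u^0*s^5 + 10*u^0*s^6 + 10*u^0*s^7 + 5*u^0*s^8 + 1*u^0*s^9 - 5*u^1*s^3 -
      26*u^1*s^4 - 55*u^1*s^5 - 60*u^1*s^6 - 35*u^1*s^7 - 10*u^1*s^8 - 1*u^1*s^9 - 2*u^2*s^1 -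
      4*u^2*s^2 + 26*u^2*s^3 + 100*u^2*s^4 + 140*u^2*s^5 + 98*u^2*s^6 + 36*u^2*s^7 + 6*u^2*s^8 +
      4*u^3*s^0 + 30*u^3*s^1 + 58*u^3*s^2 + 28*u^3*s^3 - 30*u^3*s^4 - 46*u^3*s^5 - 30*u^3*s^6 -
      12*u^3*s^7 - 2*u^3*s^8 - 26*u^4*s^0 - 122*u^4*s^1 - 215*u^4*s^2 - 265*u^4*s^3 -
      260*u^4*s^4 - 148*u^4*s^5 - 47*u^4*s^6 - 5*u^4*s^7 + 61*u^5*s^0 + 198*u^5*s^1 +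
      297*u^5*s^2 + 348*u^5*s^3 + 263*u^5*s^4 + 98*u^5*s^5 + 15*u^5*s^6 - 60*u^6*s^0 -
      128*u^6*s^1 - 142*u^6*s^2 - 118*u^6*s^3 - 42*u^6*s^4 - 6*u^6*s^5 + 20*u^7*s^0 + 24*u^7*s^1
      + 16*u^7*s^2 + 4*u^7*s^3) := by
    rw [key]
    have p0 := mul_pos (mul_pos (mul_pos (pow_pos hs 4) b0) (pow_pos hd' 0)) (pow_pos he' 7)
    have p1 := mul_pos (mul_pos (mul_pos (pow_pos hs 2) b1) (pow_pos hd' 1)) (pow_pos he' 6)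
    have p2 := mul_pos (mul_pos (mul_pos (pow_pos hs 1) b2) (pow_pos hd' 2)) (pow_pos he' 5)
    have p3 := mul_pos (mul_pos (mul_pos (pow_pos hs 0) b3) (pow_pos hd' 3)) (pow_pos he' 4)
    have p4 := mul_pos (mul_pos (mul_pos (pow_pos hs 0) b4) (pow_pos hd' 4)) (pow_pos he' 3)
    have p5 := mul_pos (mul_pos (mul_pos (pow_pos hs 0) b5) (pow_pos hd' 5)) (pow_pos he' 2)
    have p6 := mul_pos (mul_pos (mul_pos (pow_pos hs 2) b6) (pow_pos hd' 6)) (pow_pos he' 1)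
    have p7 := mul_pos (mul_pos (mul_pos (pow_pos hs 4) b7) (pow_pos hd' 7)) (pow_pos he' 0)
    exact add_pos (add_pos (add_pos (add_pos (add_pos (add_pos (add_pos p0 p1) p2) p3) p4) p5) p6) p7
  exact pos_of_mul_pos_right h2 (by positivity)

noncomputable def f0 (m r x : ℝ) : ℝ :=
  (2*(r-m)/r^2)^2*x^2 - (2*(r-m)/r^2)^2*r*x + (m^2/r^2 - 2*m/r) + 2*m/x - m^2/x^2
noncomputable def f1 (m r x : ℝ) : ℝ :=
  2*(2*(r-m)/r^2)^2*x - (2*(r-m)/r^2)^2*r - 2*m/x^2 + 2*m^2/x^3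
noncomputable def f2 (m r x : ℝ) : ℝ :=
  2*((2*(r-m)/r^2)^2 + (2*m/x^3 - 3*m^2/x^4))
noncomputable def f3 (m x : ℝ) : ℝ := -12*m/x^4 + 24*m^2/x^5
noncomputable def zc (m r : ℝ) : ℝ := -2*(r - 2*m)/r^3
noncomputable def lc (m r x : ℝ) : ℝ := zc m r * x - m/r^2
noncomputable def kc (m r : ℝ) : ℝ := -(2*m*(r - 2*m) / (r * (3*m - 2*r) * (m - r)^2))
noncomputable def Ac (m r x : ℝ) : ℝ := (f1 m r x)^2/4 - f0 m r x * f2 m r x / 2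
noncomputable def Nc (m r x : ℝ) : ℝ :=
  zc m r * f0 m r x - f1 m r x * lc m r x / 2 + kc m r * (f0 m r x)^2

lemma hasDeriv_f0 (m r x : ℝ) (hx : x ≠ 0) : HasDerivAt (f0 m r) (f1 m r x) x := by
  have h := (((((hasDerivAt_id x).pow 2).const_mul ((2*(r-m)/r^2)^2)).sub
    ((hasDerivAt_id x).const_mul ((2*(r-m)/r^2)^2*r))).add_const (m^2/r^2 - 2*m/r)).add
    ((hasDerivAt_inv hx).const_mul (2*m)) |>.sub
    (((hasDerivAt_inv hx).pow 2).const_mul (m^2))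
  refine (h.congr_deriv ?_).congr_of_eventuallyEq (Filter.Eventually.of_forall fun y => ?_)
  · simp only [f1, id, Nat.cast_ofNat, show (2-1:ℕ) = 1 from rfl,
      show (3-1:ℕ) = 2 from rfl, show (4-1:ℕ) = 3 from rfl]
    generalize (2*(r-m)/r^2)^2 = b
    field_simp
    ring
  · simp [f0]
    ring

lemma hasDeriv_f1 (m r x : ℝ) (hx : x ≠ 0) : HasDerivAt (f1 m r) (f2 m r x) x := by
  have h := (((hasDerivAt_id x).const_mul (2*(2*(r-m)/r^2)^2)).sub_const
    ((2*(r-m)/r^2)^2*r)).sub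
    (((hasDerivAt_inv hx).pow 2).const_mul (2*m)) |>.add
    (((hasDerivAt_inv hx).pow 3).const_mul (2*m^2))
  refine (h.congr_deriv ?_).congr_of_eventuallyEq (Filter.Eventually.of_forall fun y => ?_)
  · simp only [f2, Nat.cast_ofNat, show (2-1:ℕ) = 1 from rfl,
      show (3-1:ℕ) = 2 from rfl, show (4-1:ℕ) = 3 from rfl]
    generalize (2*(r-m)/r^2)^2 = b
    field_simp
    ring
  · simp [f1]
    ring

lemma hasDeriv_f2 (m r x : ℝ) (hx : x ≠ 0) : HasDerivAt (f2 m r) (f3 m x) x := by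
  have h := ((((hasDerivAt_inv hx).pow 3).const_mul (2*m)).sub
    (((hasDerivAt_inv hx).pow 4).const_mul (3*m^2))).const_add ((2*(r-m)/r^2)^2) |>.const_mul 2
  refine (h.congr_deriv ?_).congr_of_eventuallyEq (Filter.Eventually.of_forall fun y => ?_)
  · simp only [f3, Nat.cast_ofNat, show (2-1:ℕ) = 1 from rfl,
      show (3-1:ℕ) = 2 from rfl, show (4-1:ℕ) = 3 from rfl]
    field_simp
    ring
  · simp [f2]
    ring

lemma hasDeriv_A (m r x : ℝ) (hx : x ≠ 0) :
    HasDerivAt (Ac m r) (-(f0 m r x * f3 m x)/2) x := by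
  have h := (((hasDeriv_f1 m r x hx).pow 2).div_const 4).sub
    (((hasDeriv_f0 m r x hx).mul (hasDeriv_f2 m r x hx)).div_const 2)
  refine (h.congr_deriv ?_).congr_of_eventuallyEq (Filter.Eventually.of_forall fun y => ?_)
  · push_cast; ring
  · simp [Ac]

lemma hasDeriv_N (m r x : ℝ) (hx : x ≠ 0) :
    HasDerivAt (Nc m r) (zc m r * f1 m r x / 2 - f2 m r x * lc m r x / 2
      + 2 * kc m r * f0 m r x * f1 m r x) x := by
  have hl : HasDerivAt (lc m r) (zc m r) x := by
    have := ((hasDerivAt_id x).const_mul (zc m r)).sub_const (m/r^2)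
    exact this.congr_deriv (mul_one _)
  have h := (((hasDeriv_f0 m r x hx).const_mul (zc m r)).sub
    (((hasDeriv_f1 m r x hx).mul hl).div_const 2)).add
    (((hasDeriv_f0 m r x hx).pow 2).const_mul (kc m r))
  refine (h.congr_deriv ?_).congr_of_eventuallyEq (Filter.Eventually.of_forall fun y => ?_)
  · push_cast; ring
  · simp [Nc]

set_option maxHeartbeats 4000000 in
lemma S_ident (r s u : ℝ) (hr : 0 < r) (hs : 0 < s) (hu0 : 0 < u) (hu : u < 1/2) :
    3 * kc (r/(1+u)) r * f1 (r/(1+u)) r (r/(1+s)) * Ac (r/(1+u)) r (r/(1+s))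
      + f3 (r/(1+u)) (r/(1+s)) * Nc (r/(1+u)) r (r/(1+s)) =
    24 * s / ((1+s) * (1+u)^5 * (1-2*u) * u^2 * r^5) * (1*u^0*s^4 + 5*u^0*s^5 + 10*u^0*s^6 + 10*u^0*s^7 + 5*u^0*s^8 + 1*u^0*s^9 - 5*u^1*s^3 -
      26*u^1*s^4 - 55*u^1*s^5 - 60*u^1*s^6 - 35*u^1*s^7 - 10*u^1*s^8 - 1*u^1*s^9 - 2*u^2*s^1 -
      4*u^2*s^2 + 26*u^2*s^3 + 100*u^2*s^4 + 140*u^2*s^5 + 98*u^2*s^6 + 36*u^2*s^7 + 6*u^2*s^8 +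
      4*u^3*s^0 + 30*u^3*s^1 + 58*u^3*s^2 + 28*u^3*s^3 - 30*u^3*s^4 - 46*u^3*s^5 - 30*u^3*s^6 -
      12*u^3*s^7 - 2*u^3*s^8 - 26*u^4*s^0 - 122*u^4*s^1 - 215*u^4*s^2 - 265*u^4*s^3 -
      260*u^4*s^4 - 148*u^4*s^5 - 47*u^4*s^6 - 5*u^4*s^7 + 61*u^5*s^0 + 198*u^5*s^1 +
      297*u^5*s^2 + 348*u^5*s^3 + 263*u^5*s^4 + 98*u^5*s^5 + 15*u^5*s^6 - 60*u^6*s^0 -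
      128*u^6*s^1 - 142*u^6*s^2 - 118*u^6*s^3 - 42*u^6*s^4 - 6*u^6*s^5 + 20*u^7*s^0 + 24*u^7*s^1
      + 16*u^7*s^2 + 4*u^7*s^3) := by
  have hr' : r ≠ 0 := hr.ne'
  have hs1 : 1 + s ≠ 0 := by positivity
  have hu1 : 1 + u ≠ 0 := by positivity
  have hu2 : 1 - 2*u ≠ 0 := by linarith
  have hu3 : u ≠ 0 := hu0.ne'
  have e0 : f0 (r/(1+u)) r (r/(1+s)) =
      (u^2*(1-s)^2 - (u-s)^2*(1+s)^2) / ((1+u)^2*(1+s)^2) := by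
    unfold f0; field_simp; ring
  have e1 : f1 (r/(1+u)) r (r/(1+s)) =
      (4*u^2*(1-s) + 2*(s-u)*(1+s)^3) / ((1+u)^2*(1+s)*r) := by
    unfold f1; field_simp; ring
  have e2 : f2 (r/(1+u)) r (r/(1+s)) =
      2*(4*u^2 + 2*(1+u)*(1+s)^3 - 3*(1+s)^4) / ((1+u)^2*r^2) := by
    unfold f2; field_simp; ring
  have e3 : f3 (r/(1+u)) (r/(1+s)) =
      12*(1+s)^4*(2*(1+s)-(1+u)) / ((1+u)^2*r^3) := by
    unfold f3; field_simp; ring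
  have ez : zc (r/(1+u)) r = 2*(1-u)/((1+u)*r^2) := by
    unfold zc; field_simp; ring
  have el : lc (r/(1+u)) r (r/(1+s)) = (2*(1-u) - (1+s))/((1+u)*(1+s)*r) := by
    unfold lc; rw [ez]; field_simp
  have ek : kc (r/(1+u)) r = 2*(1-u)*(1+u)/((1-2*u)*u^2*r^2) := by
    have a1 : 3*(r/(1+u)) - 2*r = r*(1-2*u)/(1+u) := by field_simp; ring
    have a2 : r/(1+u) - r = -(r*u/(1+u)) := by field_simp; ring
    unfold kc; rw [a1, a2]; field_simp; ring
  have eA : Ac (r/(1+u)) r (r/(1+s)) =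
      ((2*u^2*(1-s) + (s-u)*(1+s)^3)^2 - (u^2*(1-s)^2 - (u-s)^2*(1+s)^2) *
        (4*u^2 + 2*(1+u)*(1+s)^3 - 3*(1+s)^4)) / ((1+u)^4*(1+s)^2*r^2) := by
    unfold Ac; rw [e0, e1, e2]; field_simp; ring
  unfold Nc
  rw [eA, e0, e1, e3, ez, el, ek]
  field_simp
  ring

lemma S_pos (m r x : ℝ) (hm : 0 < m) (h1 : m < r) (h2 : r < 3*m/2) (hx : 0 < x) (hxr : x < r)
    (hp : 0 < 2*(r-m)*x^2 + m*r*x - m*r^2) :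
    0 < 3 * kc m r * f1 m r x * Ac m r x + f3 m x * Nc m r x := by
  have hr : 0 < r := by linarith
  obtain ⟨u, hu⟩ : ∃ u, u = (r-m)/m := ⟨_, rfl⟩
  obtain ⟨s, hs⟩ : ∃ s, s = (r-x)/x := ⟨_, rfl⟩
  have u0 : 0 < u := by rw [hu]; exact div_pos (by linarith) hm
  have s0 : 0 < s := by rw [hs]; exact div_pos (by linarith) hx
  have u1 : u < 1/2 := by rw [hu, div_lt_iff₀ hm]; linarith
  have em : m = r/(1+u) := by
    rw [eq_div_iff (by positivity), hu]; field_simp; ring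
  have ex : x = r/(1+s) := by
    rw [eq_div_iff (by positivity), hs]; field_simp; ring
  have hd : s + s^2 < 2*u := by
    have : 2*u - (s+s^2) = (2*(r-m)*x^2 + m*r*x - m*r^2)/(m*x^2) := by
      rw [hu, hs]; field_simp; ring
    have h3 : 0 < 2*u - (s+s^2) := by rw [this]; positivity
    linarith
  rw [em, ex, S_ident r s u hr s0 u0 u1]
  have := R_pos s u s0 u1 hd
  have h4 : 0 < 1 - 2*u := by linarith
  exact mul_pos (by positivity) this

lemma betaConst_sq (m r : ℝ) (hm : 0 < m) (h1 : m < r) :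
    (betaConst m m r)^2 = (2*(r-m)/r^2)^2 := by
  have hr : r ≠ 0 := by linarith
  have hD : D m m r = ((r-m)/r)^2 := by unfold D; field_simp; ring
  have : 0 ≤ (r-m)/r := div_nonneg (by linarith) (by linarith)
  unfold betaConst
  rw [hD, Real.sqrt_sq this]
  field_simp

lemma roots_facts (m r a₁ a₂ a₃ : ℝ) (hm : 0 < m) (h1 : m < r) (h2 : r < 3*m/2)
    (h12 : a₁ < a₂) (h23 : a₂ < a₃)
    (ha₁ : Qcubic m m r a₁ = 0) (ha₂ : Qcubic m m r a₂ = 0) (ha₃ : Qcubic m m r a₃ = 0) :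
    (∀ x, x ≠ 0 → Fcoeff m r a₁ a₂ a₃ x = f0 m r x) ∧ 0 < a₂ ∧
    (∀ x ∈ Set.Ioo a₂ r, 0 < 2*(r-m)*x^2 + m*r*x - m*r^2 ∧ 0 < f0 m r x) := by
  have hr : 0 < r := by linarith
  have hrm : 0 < r - m := by linarith
  have hb : 0 < (2*(r-m)/r^2)^2 := by positivity
  have hη : etaCoeff m m r * (2*(r-m)/r^2)^2 = m^2/r^2 - 2*m/r := by
    unfold etaCoeff
    rw [betaConst_sq m r hm h1, div_mul_cancel₀ _ hb.ne']
    unfold D; ring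
  have hξ : xiCoeff m m r * (2*(r-m)/r^2)^2 = m^2/r := by
    unfold xiCoeff
    rw [betaConst_sq m r hm h1]
    field_simp
  have hξ0 : 0 < xiCoeff m m r := by
    have : 0 < xiCoeff m m r * (2*(r-m)/r^2)^2 := by rw [hξ]; positivity
    exact pos_of_mul_pos_left this hb.le
  unfold Qcubic at ha₁ ha₂ ha₃
  generalize etaCoeff m m r = η at *
  generalize xiCoeff m m r = ξ at *
  have e1 : a₁^2 + a₁*a₂ + a₂^2 + η = 0 := by
    have : (a₁ - a₂) * (a₁^2 + a₁*a₂ + a₂^2 + η) = 0 := by linear_combination ha₁ - ha₂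
    rcases mul_eq_zero.1 this with h | h
    · linarith
    · exact h
  have e2 : a₂^2 + a₂*a₃ + a₃^2 + η = 0 := by
    have : (a₂ - a₃) * (a₂^2 + a₂*a₃ + a₃^2 + η) = 0 := by linear_combination ha₂ - ha₃
    rcases mul_eq_zero.1 this with h | h
    · linarith
    · exact h
  have e3 : a₁ + a₂ + a₃ = 0 := by
    have : (a₁ - a₃) * (a₁ + a₂ + a₃) = 0 := by linear_combination e1 - e2
    rcases mul_eq_zero.1 this with h | h
    · linarith
    · exact h
  have e4 : a₁ = -a₂ - a₃ := by linarith
  have hfac : ∀ x, (x - a₁)*(x - a₂)*(x - a₃) = x^3 + η*x + ξ := by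
    intro x
    have eη : η = -(a₂^2 + a₂*a₃ + a₃^2) := by linarith
    have eξ : ξ = -(a₂^3 + η*a₂) := by linarith
    rw [eξ, eη, e4]; ring
  have hF : ∀ x, x ≠ 0 → Fcoeff m r a₁ a₂ a₃ x = f0 m r x := by
    intro x hx
    have : Fcoeff m r a₁ a₂ a₃ x
        = ((2*(r-m)/r^2)^2 / x^2) * (x - r) * ((x - a₁)*(x - a₂)*(x - a₃)) := by
      unfold Fcoeff; ring
    rw [this, hfac]
    have : ((2*(r-m)/r^2)^2 / x^2) * (x - r) * (x^3 + η*x + ξ) =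
      (x - r) / x^2 * ((2*(r-m)/r^2)^2 * x^3 + (η*(2*(r-m)/r^2)^2) * x
        + ξ*(2*(r-m)/r^2)^2) := by ring
    rw [this, hη, hξ]
    unfold f0
    generalize (2*(r-m)/r^2)^2 = b
    field_simp
    ring
  have hprod : a₁*a₂*a₃ = -ξ := by
    have := hfac 0
    linear_combination -this
  have ha2 : 0 < a₂ := by
    by_contra hneg
    push Not at hneg
    have h3 : 0 < a₃ := by linarith
    have h4 : a₁ < 0 := by linarith
    have : 0 ≤ a₁*a₂*a₃ := mul_nonneg (mul_nonneg_of_nonpos_of_nonpos h4.le hneg) h3.le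
    linarith
  refine ⟨hF, ha2, ?_⟩
  rintro x ⟨hx1, hx2⟩
  have hx0 : 0 < x := by linarith
  -- the explicit factorisation
  have hQ : ∀ x, (2*(r-m)/r^2)^2 * (x^3 + η*x + ξ) =
      (2*(r-m)*x - m*r) * (2*(r-m)*x^2 + m*r*x - m*r^2) / r^4 := by
    intro x
    have : (2*(r-m)/r^2)^2 * (x^3 + η*x + ξ) = (2*(r-m)/r^2)^2 * x^3
      + (η*(2*(r-m)/r^2)^2) * x + ξ*(2*(r-m)/r^2)^2 := by ring
    rw [this, hη, hξ]
    field_simp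
    ring
  obtain ⟨A, hA⟩ : ∃ A, A = m*r/(2*(r-m)) := ⟨_, rfl⟩
  have hAr : r < A := by
    rw [hA, lt_div_iff₀ (by positivity)]; nlinarith
  have hA0 : 2*(r-m)*A - m*r = 0 := by rw [hA]; field_simp; ring
  have hAroot : (A - a₁)*(A - a₂)*(A - a₃) = 0 := by
    have := hQ A
    rw [hA0, zero_mul, zero_div, ← hfac] at this
    rcases mul_eq_zero.1 this with h | h
    · exact absurd h hb.ne'
    · exact h
  have hA3 : A = a₃ := by
    rcases mul_eq_zero.1 hAroot with h | h
    · rcases mul_eq_zero.1 h with h | h <;> linarith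
    · linarith
  have hneg : (x - a₁)*(x - a₂)*(x - a₃) < 0 :=
    mul_neg_of_pos_of_neg (mul_pos (by linarith) (by linarith)) (by linarith)
  constructor
  · have h3 := hQ x
    rw [← hfac] at h3
    have h4 : (2*(r-m)*x - m*r) * (2*(r-m)*x^2 + m*r*x - m*r^2) / r^4 < 0 := by
      rw [← h3]; exact mul_neg_of_pos_of_neg hb hneg
    have h5 : 2*(r-m)*x - m*r < 0 := by nlinarith
    by_contra hc
    push Not at hc
    have : 0 ≤ (2*(r-m)*x - m*r) * (2*(r-m)*x^2 + m*r*x - m*r^2) / r^4 :=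
      div_nonneg (mul_nonneg_of_nonpos_of_nonpos h5.le hc) (by positivity)
    linarith
  · rw [← hF x hx0.ne']
    have : Fcoeff m r a₁ a₂ a₃ x
        = ((2*(r-m)/r^2)^2 / x^2) * ((x - r) * ((x - a₁)*(x - a₂)*(x - a₃))) := by
      unfold Fcoeff; ring
    rw [this]
    exact mul_pos (by positivity) (mul_pos_of_neg_of_neg (by linarith) hneg)

lemma f0_rs (m r : ℝ) (hr : 0 < r) : f0 m r r = 0 := by
  unfold f0; field_simp; ring

lemma f1_rs (m r : ℝ) (hr : 0 < r) : f1 m r r = 2*(r-m)*(2*r-3*m)/r^3 := by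
  unfold f1; field_simp; ring

/-- Sign of the second derivative of the deviation scalar, extremal case: for
`r_* ∈ (m, 3m/2)`, `α₁ < α₂ < α₃` the roots of `Q`, and `ω` a twice continuously
differentiable solution on `(α₂, r_*]` of the reparametrised deviation equation
`F·ω″ + G·ω′ - (β² + χ)·ω = ζ` with `G = (1/2)F′` and the stated boundary values at
`r_*`, one has `ω″(x) < ω̈_*` for all `x ∈ (α₂, r_*)`. -/
theorem second_derivative_deviation_extremal (m rs a₁ a₂ a₃ : ℝ) (ω ω' ω'' : ℝ → ℝ)
    (hm : 0 < m) (h1 : m < rs) (h2 : rs < 3*m/2)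
    (h12 : a₁ < a₂) (h23 : a₂ < a₃)
    (ha₁ : Qcubic m m rs a₁ = 0) (ha₂ : Qcubic m m rs a₂ = 0) (ha₃ : Qcubic m m rs a₃ = 0)
    (hd1 : ∀ x ∈ Set.Ioc a₂ rs, HasDerivWithinAt ω (ω' x) (Set.Ioc a₂ rs) x)
    (hd2 : ∀ x ∈ Set.Ioc a₂ rs, HasDerivWithinAt ω' (ω'' x) (Set.Ioc a₂ rs) x)
    (hcont : ContinuousOn ω'' (Set.Ioc a₂ rs))
    (heq : ∀ x ∈ Set.Ioo a₂ rs,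
      Fcoeff m rs a₁ a₂ a₃ x * ω'' x
        + ((1/2) * deriv (Fcoeff m rs a₁ a₂ a₃) x) * ω' x
        - ((2*(rs - m)/rs^2)^2 + (2*m/x^3 - 3*m^2/x^4)) * ω x
      = -2*(rs - 2*m)/rs^3)
    (hb0 : ω rs = rs/(rs - m))
    (hb1 : ω' rs = (3*m^2 - 2*rs^2) / ((3*m - 2*rs) * (m - rs)^2))
    (hb2 : ω'' rs = 2*m*(rs - 2*m) / (rs * (3*m - 2*rs) * (m - rs)^2)) :
    ∀ x ∈ Set.Ioo a₂ rs,
      ω'' x < 2*m*(rs - 2*m) / (rs * (3*m - 2*rs) * (m - rs)^2) := by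
  obtain ⟨hF, ha2, hreg⟩ := roots_facts m rs a₁ a₂ a₃ hm h1 h2 h12 h23 ha₁ ha₂ ha₃
  have hr : 0 < rs := by linarith
  have hrm : rs - m ≠ 0 := by linarith
  have h3m : 3*m - 2*rs ≠ 0 := by linarith
  have hpos : ∀ x ∈ Set.Ioc a₂ rs, x ≠ 0 := fun x hx => by linarith [hx.1]
  have hnhds : ∀ x ∈ Set.Ioo a₂ rs, Set.Ioc a₂ rs ∈ nhds x := fun x hx =>
    Ioc_mem_nhds hx.1 hx.2
  have hder : ∀ x ∈ Set.Ioo a₂ rs, deriv (Fcoeff m rs a₁ a₂ a₃) x = f1 m rs x := by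
    intro x hx
    have hx0 := hpos x ⟨hx.1, hx.2.le⟩
    refine HasDerivAt.deriv ((hasDeriv_f0 m rs x hx0).congr_of_eventuallyEq ?_)
    filter_upwards [isOpen_ne.mem_nhds hx0] with y hy using hF y hy
  have hode : ∀ x ∈ Set.Ioo a₂ rs, f0 m rs x * ω'' x + f1 m rs x / 2 * ω' x
      - f2 m rs x / 2 * ω x = zc m rs := by
    intro x hx
    have := heq x hx
    rw [hF x (hpos x ⟨hx.1, hx.2.le⟩), hder x hx] at this
    unfold zc
    rw [← this]
    unfold f2
    ring
  -- the first integral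
  have hfirst : ∀ y ∈ Set.Ioo a₂ rs,
      f0 m rs y * ω' y = f1 m rs y / 2 * ω y + lc m rs y := by
    intro y hy
    have hsub : Set.Icc y rs ⊆ Set.Ioc a₂ rs := fun z hz => ⟨by linarith [hz.1, hy.1], hz.2⟩
    have hc := constant_of_has_deriv_right_zero
      (f := fun z => f0 m rs z * ω' z - f1 m rs z / 2 * ω z - zc m rs * z) (a := y) (b := rs)
      (by
        intro z hz
        have hz' := hsub hz
        have c0 := (hasDeriv_f0 m rs z (hpos z hz')).continuousAt.continuousWithinAt
          (s := Set.Icc y rs)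
        have c1 := (hasDeriv_f1 m rs z (hpos z hz')).continuousAt.continuousWithinAt
          (s := Set.Icc y rs)
        have w0 := (hd1 z hz').continuousWithinAt.mono hsub
        have w1 := (hd2 z hz').continuousWithinAt.mono hsub
        exact ((c0.mul w1).sub ((c1.div_const 2).mul w0)).sub
          (continuousWithinAt_const.mul continuousWithinAt_id))
      (by
        intro z hz
        have hz' : z ∈ Set.Ioo a₂ rs := ⟨by linarith [hz.1, hy.1], hz.2⟩
        have hz'' : z ∈ Set.Ioc a₂ rs := ⟨hz'.1, hz'.2.le⟩
        have d0 := hasDeriv_f0 m rs z (hpos z hz'')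
        have d1 := hasDeriv_f1 m rs z (hpos z hz'')
        have w0 := (hd1 z hz'').hasDerivAt (hnhds z hz')
        have w1 := (hd2 z hz'').hasDerivAt (hnhds z hz')
        have h := ((d0.mul w1).sub ((d1.div_const 2).mul w0)).sub
          ((hasDerivAt_id z).const_mul (zc m rs))
        refine HasDerivAt.hasDerivWithinAt (h.congr_deriv ?_)
        linear_combination hode z hz')
      rs ⟨hy.2.le, le_refl _⟩
    beta_reduce at hc
    rw [f0_rs m rs hr, f1_rs m rs hr, hb0] at hc
    have hv : 2*(rs-m)*(2*rs-3*m)/rs^3 / 2 * (rs/(rs-m)) + zc m rs * rs = m/rs^2 := by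
      unfold zc; field_simp; ring
    unfold lc
    linear_combination (-1 : ℝ) * hc - hv
  -- positivity of A
  have hA0 : 0 < Ac m rs rs := by
    have : f1 m rs rs ≠ 0 := by
      rw [f1_rs m rs hr]
      have : 2*rs - 3*m ≠ 0 := by linarith
      positivity
    unfold Ac
    rw [f0_rs m rs hr]
    have : 0 < (f1 m rs rs)^2 := by positivity
    linarith
  have hApos : ∀ y ∈ Set.Ioc a₂ rs, 0 < Ac m rs y := by
    intro y hy
    have hsub : Set.Icc y rs ⊆ Set.Ioc a₂ rs := fun z hz => ⟨by linarith [hz.1, hy.1], hz.2⟩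
    have hanti : AntitoneOn (Ac m rs) (Set.Icc y rs) := by
      apply antitoneOn_of_deriv_nonpos (convex_Icc y rs)
      · intro z hz
        exact (hasDeriv_A m rs z (hpos z (hsub hz))).continuousAt.continuousWithinAt
      · intro z hz
        rw [interior_Icc] at hz
        exact (hasDeriv_A m rs z (hpos z (hsub ⟨hz.1.le, hz.2.le⟩))).differentiableAt.differentiableWithinAt
      · intro z hz
        rw [interior_Icc] at hz
        have hz0 : 0 < z := by linarith [hz.1, hy.1]
        rw [(hasDeriv_A m rs z hz0.ne').deriv]
        have hf := (hreg z ⟨by linarith [hz.1, hy.1], hz.2⟩).2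
        have hf3 : 0 < f3 m z := by
          have : f3 m z = 12*m*(2*m - z)/z^5 := by unfold f3; field_simp; ring
          rw [this]
          have : 0 < 2*m - z := by linarith [hz.2]
          positivity
        have := mul_pos hf hf3
        linarith
    have := hanti ⟨le_refl _, hy.2⟩ ⟨hy.2, le_refl _⟩ hy.2
    linarith
  have hV : ∀ y ∈ Set.Ioo a₂ rs,
      (f0 m rs y)^2 * (ω'' y + kc m rs) = Nc m rs y - Ac m rs y * ω y := by
    intro y hy
    unfold Nc Ac
    linear_combination f0 m rs y * hode y hy - f1 m rs y / 2 * hfirst y hy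
  intro x hx
  have hsub : Set.Icc x rs ⊆ Set.Ioc a₂ rs := fun z hz => ⟨by linarith [hz.1, hx.1], hz.2⟩
  have hmono : StrictMonoOn
      (fun y => Real.sqrt (f0 m rs y) * f0 m rs y * (ω'' y + kc m rs) / Ac m rs y)
      (Set.Icc x rs) := by
    apply strictMonoOn_of_deriv_pos (convex_Icc x rs)
    · intro z hz
      have hz' := hsub hz
      have c0 := (hasDeriv_f0 m rs z (hpos z hz')).continuousAt.continuousWithinAt
        (s := Set.Icc x rs)
      have cA := (hasDeriv_A m rs z (hpos z hz')).continuousAt.continuousWithinAt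
        (s := Set.Icc x rs)
      have cw := (hcont z hz').mono hsub
      exact ((c0.sqrt.mul c0).mul (cw.add continuousWithinAt_const)).div cA (hApos z hz').ne'
    · intro z hz
      rw [interior_Icc] at hz
      have hz' : z ∈ Set.Ioo a₂ rs := ⟨by linarith [hz.1, hx.1], hz.2⟩
      have hz'' : z ∈ Set.Ioc a₂ rs := ⟨hz'.1, hz'.2.le⟩
      have hz0 : 0 < z := by linarith [hz'.1]
      obtain ⟨hp, hf⟩ := hreg z hz'
      have hA := hApos z hz''
      have dA := hasDeriv_A m rs z hz0.ne'
      have dN := hasDeriv_N m rs z hz0.ne'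
      have d0 := hasDeriv_f0 m rs z hz0.ne'
      have w0 := (hd1 z hz'').hasDerivAt (hnhds z hz')
      have hsq : 0 < Real.sqrt (f0 m rs z) := Real.sqrt_pos.2 hf
      have hss : Real.sqrt (f0 m rs z) ^ 2 = f0 m rs z := Real.sq_sqrt hf.le
      have h := ((dN.div dA hA.ne').sub w0).div (d0.sqrt hf.ne') hsq.ne'
      have hev : (fun y => Real.sqrt (f0 m rs y) * f0 m rs y * (ω'' y + kc m rs) / Ac m rs y)
          =ᶠ[nhds z] ((Nc m rs / Ac m rs - ω) / fun y => Real.sqrt (f0 m rs y)) := by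
        filter_upwards [Ioo_mem_nhds hz'.1 hz'.2] with y hy
        have hfy := (hreg y hy).2
        have hAy := hApos y ⟨hy.1, hy.2.le⟩
        have hsy : 0 < Real.sqrt (f0 m rs y) := Real.sqrt_pos.2 hfy
        have hsy2 : Real.sqrt (f0 m rs y) ^ 2 = f0 m rs y := Real.sq_sqrt hfy.le
        have hVy := hV y hy
        simp only [Pi.div_apply, Pi.sub_apply]
        rw [eq_div_iff hsy.ne']
        field_simp
        rw [hsy2]
        linear_combination hVy
      have hS := S_pos m rs z hm h1 h2 hz0 hz'.2 hp
      rw [(h.congr_of_eventuallyEq hev).deriv]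
      have hfz := hfirst z hz'
      have hw : ω' z = (f1 m rs z / 2 * ω z + lc m rs z) / f0 m rs z := by
        rw [eq_div_iff hf.ne']; linear_combination hfz
      have hfin : (((zc m rs * f1 m rs z / 2 - f2 m rs z * lc m rs z / 2
            + 2 * kc m rs * f0 m rs z * f1 m rs z) * Ac m rs z
            - Nc m rs z * (-(f0 m rs z * f3 m z)/2)) / Ac m rs z ^ 2 - ω' z)
            * Real.sqrt (f0 m rs z)
            - (Nc m rs z / Ac m rs z - ω z) * (f1 m rs z / (2 * Real.sqrt (f0 m rs z)))
          = (f0 m rs z)^2 / (2 * (Ac m rs z)^2 * Real.sqrt (f0 m rs z)) *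
            (3 * kc m rs * f1 m rs z * Ac m rs z + f3 m z * Nc m rs z) := by
        have hAdef : Ac m rs z = (f1 m rs z)^2/4 - f0 m rs z * f2 m rs z / 2 := rfl
        have hNdef : Nc m rs z = zc m rs * f0 m rs z - f1 m rs z * lc m rs z / 2
          + kc m rs * (f0 m rs z)^2 := rfl
        rw [hw]
        generalize Real.sqrt (f0 m rs z) = q at *
        generalize Ac m rs z = A at *
        generalize Nc m rs z = N at *
        generalize f0 m rs z = f at *
        generalize f1 m rs z = g at *
        generalize f2 m rs z = g2 at *
        generalize f3 m z = g3 at *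
        generalize lc m rs z = l at *
        generalize zc m rs = ζ at *
        generalize kc m rs = k at *
        field_simp
        rw [hss]
        have hk : f * (ζ * g / 2 - g2 * l / 2 + 2 * k * f * g) - g / 2 * N - l * A
            - 3 / 2 * k * f^2 * g = 0 := by rw [hAdef, hNdef]; ring
        linear_combination (2*A*f) * hk
      refine div_pos ?_ (by positivity)
      simp only [Pi.div_apply, Pi.sub_apply]
      rw [hfin]
      positivity
  have hlt := hmono ⟨le_refl _, hx.2.le⟩ ⟨hx.2.le, le_refl _⟩ hx.2
  simp only [f0_rs m rs hr, mul_zero, zero_mul, zero_div] at hlt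
  have hf := (hreg x hx).2
  have hA := hApos x ⟨hx.1, hx.2.le⟩
  have hsq : 0 < Real.sqrt (f0 m rs x) := Real.sqrt_pos.2 hf
  by_contra hc
  push Not at hc
  have h0 : 0 ≤ ω'' x + kc m rs := by unfold kc; linarith
  have : 0 ≤ Real.sqrt (f0 m rs x) * f0 m rs x * (ω'' x + kc m rs) / Ac m rs x := by positivity
  linarith
end

section
/- (Minimum of the turning point radius in the extremal case.) Let m > 0 and define a(s) = (s/(4(s − m)))·(√(m(8s − 7m)) − m) for s ∈ (m, ∞) (the value α₂ of the turning point of the conformal curve with initial radius r_* = s in the extremal Reissner–Nordström spacetime). Then a(s) ≥ (√2 − 1/2)·m for all s ∈ (m, ∞), with equality if and only if s = (2 − 1/√2)·m. -/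
/-- Minimum of the turning-point radius in the extremal Reissner–Nordström spacetime:
for `m > 0` the turning-point radius
`a(s) = (s/(4(s - m)))·(√(m(8s - 7m)) - m)` of the conformal curve with initial radius
`s > m` satisfies `a(s) ≥ (√2 - 1/2)·m`, with equality iff `s = (2 - 1/√2)·m`. -/
theorem turning_point_minimum_extremal (m : ℝ) (hm : 0 < m) :
    ∀ s : ℝ, m < s →
      ((Real.sqrt 2 - 1/2) * m
          ≤ (s/(4*(s - m))) * (Real.sqrt (m*(8*s - 7*m)) - m))
      ∧ ((s/(4*(s - m))) * (Real.sqrt (m*(8*s - 7*m)) - m) = (Real.sqrt 2 - 1/2) * m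
          ↔ s = (2 - 1/Real.sqrt 2) * m) := by
  intro s hs
  have hw : Real.sqrt 2 ^ 2 = 2 := Real.sq_sqrt (by norm_num)
  have hw1 : 1 < Real.sqrt 2 := by
    rw [Real.lt_sqrt (by norm_num)]; norm_num
  have hinv : 1 / Real.sqrt 2 = Real.sqrt 2 / 2 := by
    rw [div_eq_div_iff (by positivity) (by norm_num)]; nlinarith
  rw [hinv]
  have hpos : 0 ≤ m*(8*s - 7*m) := mul_nonneg hm.le (by linarith)
  have hu2 : Real.sqrt (m*(8*s - 7*m)) ^ 2 = m*(8*s - 7*m) := Real.sq_sqrt hpos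
  have hu0 : 0 ≤ Real.sqrt (m*(8*s - 7*m)) := Real.sqrt_nonneg _
  generalize Real.sqrt (m*(8*s - 7*m)) = u at *
  generalize Real.sqrt 2 = w at *
  have hsm : s - m ≠ 0 := by linarith
  have ht : 0 < u + m := by linarith
  have key : (s/(4*(s - m))) * (u - m) - (w - 1/2) * m
      = (u + m - 2*w*m)^2 / (4*(u+m)) := by
    have h1 : (s/(4*(s - m))) * (u - m) = 2*m*s/(u+m) := by
      rw [div_mul_eq_mul_div, div_eq_div_iff (by simpa using hsm) ht.ne']
      linear_combination s * hu2
    rw [h1]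
    field_simp
    linear_combination (-2) * hu2 - 8 * m^2 * hw
  constructor
  · have : 0 ≤ (u + m - 2*w*m)^2 / (4*(u+m)) := by positivity
    linarith
  · rw [← sub_eq_zero, key, div_eq_zero_iff]
    constructor
    · rintro (h | h)
      · have h2 : u + m - 2*w*m = 0 := by simpa using h
        have hu : u = (2*w - 1)*m := by linarith
        subst hu
        apply mul_left_cancel₀ hm.ne'
        linear_combination (-1/8) * hu2 + m^2/2 * hw
      · linarith
    · intro h
      left
      have h2 : u ^ 2 = ((2*w-1)*m)^2 := by
        rw [hu2, h]; linear_combination (-4) * m^2 * hw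
      have h3 : u = (2*w-1)*m :=
        (pow_left_inj₀ hu0 (mul_nonneg (by linarith) hm.le) two_ne_zero).1 h2
      rw [h3]; ring
end
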